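/- Outer Appell property: for all integers 0 ≤ l ≤ n, the outer Appell functions satisfy ∂₀A_{−(n+2)}^l = −(n+2)·A_{−(n+3)}^l on ℝ³ ∖ {0}. -/

import Mathlib

open MeasureTheory Metric Finset

noncomputable section

/-- `ℝ³` with the Euclidean norm and Lebesgue measure. -/
abbrev R3 := EuclideanSpace ℝ (Fin 3)
/-- the real quaternions ℍ -/
abbrev QH := Quaternion ℝ

/-- the basis quaternion e₁ -/
def e1 : QH := ⟨0,1,0,0⟩
/-- the basis quaternion e₂ -/
def e2 : QH := ⟨0,0,1,0⟩
/-- the basis quaternion e₃ -/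
def e3 : QH := ⟨0,0,0,1⟩

/-- embed a point of ℝ³ as the reduced quaternion x₀ + x₁e₁ + x₂e₂ -/
def toQ (x : R3) : QH := ⟨x 0, x 1, x 2, 0⟩
/-- the conjugate reduced quaternion x₀ - x₁e₁ - x₂e₂ -/
def toQbar (x : R3) : QH := ⟨x 0, -(x 1), -(x 2), 0⟩
/-- ζ = x₁ - x₂e₃ -/
def zeta (x : R3) : QH := ⟨x 1, 0, 0, -(x 2)⟩

/-- build a point of ℝ³ from coordinates -/
def mk3 (a b c : ℝ) : R3 := (WithLp.equiv 2 (Fin 3 → ℝ)).symm ![a, b, c]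

/-- the conjugated point (x₀, -x₁, -x₂) -/
def barPt (x : R3) : R3 := mk3 (x 0) (-(x 1)) (-(x 2))

/-- partial derivative ∂f/∂xᵢ -/
def pd (i : Fin 3) (f : R3 → QH) (x : R3) : QH :=
  fderiv ℝ f x (EuclideanSpace.single i 1)

/-- the generalized Cauchy-Riemann operator ∂̄f = ∂f/∂x₀ + e₁∂f/∂x₁ + e₂∂f/∂x₂ -/
def CRbar (f : R3 → QH) (x : R3) : QH :=
  pd 0 f x + e1 * pd 1 f x + e2 * pd 2 f x

/-- the adjoint generalized Cauchy-Riemann operator ∂f = ∂f/∂x₀ - e₁∂f/∂x₁ - e₂∂f/∂x₂ -/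
def Dadj (f : R3 → QH) (x : R3) : QH :=
  pd 0 f x - e1 * pd 1 f x - e2 * pd 2 f x

/-- the hypercomplex derivative ∂₀ = (1/2)∂ -/
def D0 (f : R3 → QH) : R3 → QH := fun x =>
  (1/2 : ℝ) • (pd 0 f x - e1 * pd 1 f x - e2 * pd 2 f x)

/-- the operator ∂̄_ℂ f = (1/2)(∂f/∂x₁ + e₃∂f/∂x₂) -/
def DbarC (f : R3 → QH) : R3 → QH := fun x =>
  (1/2 : ℝ) • (pd 1 f x + e3 * pd 2 f x)

/-- the involution f⁰ + f¹e₁ + f²e₂ + f³e₃ ↦ f⁰ - f¹e₁ - f²e₂ + f³e₃ -/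
def invol (a : QH) : QH := ⟨a.re, -a.imI, -a.imJ, a.imK⟩

/-- the inner Appell polynomial A_n^l -/
def appell (n l : ℕ) (x : R3) : QH :=
  ((n.factorial * l.factorial : ℝ) /
      (2 ^ (2 * (n - l)) * (n + l + 1).factorial * (2 * l).factorial)) •
    ((∑ h ∈ Finset.range (n - l + 1),
        (((2 * n - 2 * h + 1).factorial * (2 * l + 2 * h).factorial : ℝ) /
            (h.factorial * (n - l - h).factorial * (n - h).factorial * (l + h).factorial)) •
          (toQbar x ^ h * toQ x ^ (n - l - h))) * zeta x ^ l)

/-- the Kelvin transform K(P)(x) = (x̄/|x|³)·P(x̄/|x|²) -/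
def kelvin (P : R3 → QH) (x : R3) : QH :=
  ((‖x‖ ^ 3)⁻¹ • toQbar x) * P ((‖x‖ ^ 2)⁻¹ • barPt x)

/-- the outer Appell function A_{-(n+2)}^l -/
def outerAppell (n l : ℕ) (x : R3) : QH :=
  (((n + l + 1).factorial * (n - l).factorial : ℝ) / (n.factorial * (n + 1).factorial)) •
    kelvin (appell n l) x

/-- surface integral over the sphere of radius ρ (parametrized by the unit sphere
with its surface measure, with the Jacobian factor ρ²) -/
def sphereIntegral (ρ : ℝ) (g : R3 → QH) : QH :=
  ∫ ω : sphere (0 : R3) 1, (ρ ^ 2) • g (ρ • (ω : R3)) ∂((volume : Measure R3).toSphere)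

/-- the unified family ψ_k^l, k ∈ ℤ \ {-1}: inner Appell polynomials for k ≥ 0,
outer Appell functions for k ≤ -2 -/
def psiFam (k : ℤ) (l : ℕ) (x : R3) : QH :=
  if 0 ≤ k then appell k.toNat l x else outerAppell (-k - 2).toNat l x

open scoped Quaternion

/-- The coefficients of the inner Appell polynomials, indexed by `m = n - l`. -/
def appellCoeff (l m h : ℕ) : ℝ :=
  ((2 * (l + m) - 2 * h + 1).factorial * (2 * l + 2 * h).factorial : ℝ) /
    (h.factorial * (m - h).factorial * (l + m - h).factorial * (l + h).factorial)

lemma appellCoeff_succ {l m h : ℕ} (hh : h ≤ m) :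
    ((m : ℝ) + 1 - h) * appellCoeff l (m + 1) h = 4 * (l + m - h + 3 / 2) * appellCoeff l m h := by
  obtain ⟨k, rfl⟩ := Nat.exists_eq_add_of_le hh
  unfold appellCoeff
  rw [show 2 * (l + (h + k + 1)) - 2 * h + 1 = 2 * (l + k) + 1 + 1 + 1 by omega,
    show 2 * (l + (h + k)) - 2 * h + 1 = 2 * (l + k) + 1 by omega,
    show h + k + 1 - h = k + 1 by omega, show h + k - h = k by omega,
    show l + (h + k + 1) - h = l + k + 1 by omega, show l + (h + k) - h = l + k by omega]
  simp only [Nat.factorial_succ]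
  push_cast
  field_simp
  ring

lemma appellCoeff_succ_succ {l m h : ℕ} (hh : h ≤ m) :
    ((h : ℝ) + 1) * appellCoeff l (m + 1) (h + 1) = 4 * (l + h + 1 / 2) * appellCoeff l m h := by
  obtain ⟨k, rfl⟩ := Nat.exists_eq_add_of_le hh
  unfold appellCoeff
  rw [show 2 * (l + (h + k + 1)) - 2 * (h + 1) + 1 = 2 * (l + k) + 1 by omega,
    show 2 * (l + (h + k)) - 2 * h + 1 = 2 * (l + k) + 1 by omega,
    show h + k + 1 - (h + 1) = k by omega, show h + k - h = k by omega,
    show l + (h + k + 1) - (h + 1) = l + k by omega, show l + (h + k) - h = l + k by omega,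
    show 2 * l + 2 * (h + 1) = 2 * l + 2 * h + 1 + 1 by omega,
    show l + (h + 1) = l + h + 1 by omega]
  simp only [Nat.factorial_succ]
  push_cast
  field_simp
  ring

/-- The outer Appell function of order `l` and degree `-(l + m + 2)`, up to a constant factor. -/
def outerSum (l m : ℕ) (x : R3) : QH :=
  (∑ h ∈ Finset.range (m + 1), appellCoeff l m h •
    ((‖x‖ ^ (2 * (l + m) + 3))⁻¹ • (toQ x ^ h * toQbar x ^ (m + 1 - h)))) * zeta x ^ l

@[simp] lemma toQ_re (x : R3) : (toQ x).re = x 0 := rfl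
@[simp] lemma toQ_imI (x : R3) : (toQ x).imI = x 1 := rfl
@[simp] lemma toQ_imJ (x : R3) : (toQ x).imJ = x 2 := rfl
@[simp] lemma toQ_imK (x : R3) : (toQ x).imK = 0 := rfl

@[simp] lemma toQbar_re (x : R3) : (toQbar x).re = x 0 := rfl
@[simp] lemma toQbar_imI (x : R3) : (toQbar x).imI = -(x 1) := rfl
@[simp] lemma toQbar_imJ (x : R3) : (toQbar x).imJ = -(x 2) := rfl
@[simp] lemma toQbar_imK (x : R3) : (toQbar x).imK = 0 := rfl

@[simp] lemma zeta_re (x : R3) : (zeta x).re = x 1 := rfl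
@[simp] lemma zeta_imI (x : R3) : (zeta x).imI = 0 := rfl
@[simp] lemma zeta_imJ (x : R3) : (zeta x).imJ = 0 := rfl
@[simp] lemma zeta_imK (x : R3) : (zeta x).imK = -(x 2) := rfl

@[simp] lemma e1_re : e1.re = 0 := rfl
@[simp] lemma e1_imI : e1.imI = 1 := rfl
@[simp] lemma e1_imJ : e1.imJ = 0 := rfl
@[simp] lemma e1_imK : e1.imK = 0 := rfl

@[simp] lemma e2_re : e2.re = 0 := rfl
@[simp] lemma e2_imI : e2.imI = 0 := rfl
@[simp] lemma e2_imJ : e2.imJ = 1 := rfl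
@[simp] lemma e2_imK : e2.imK = 0 := rfl

@[simp] lemma e3_re : e3.re = 0 := rfl
@[simp] lemma e3_imI : e3.imI = 0 := rfl
@[simp] lemma e3_imJ : e3.imJ = 0 := rfl
@[simp] lemma e3_imK : e3.imK = 1 := rfl

lemma toQ_eq (x : R3) : toQ x = x 0 • (1 : QH) + x 1 • e1 + x 2 • e2 := by
  apply Quaternion.ext <;> simp

lemma toQbar_eq (x : R3) : toQbar x = x 0 • (1 : QH) - x 1 • e1 - x 2 • e2 := by
  apply Quaternion.ext <;> simp

lemma zeta_eq (x : R3) : zeta x = x 1 • (1 : QH) - x 2 • e3 := by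
  apply Quaternion.ext <;> simp

lemma norm_sq_eq (x : R3) : ‖x‖ ^ 2 = x 0 ^ 2 + x 1 ^ 2 + x 2 ^ 2 := by
  simp [EuclideanSpace.norm_sq_eq, Fin.sum_univ_three]

lemma toQ_mul_toQbar (x : R3) : toQ x * toQbar x = (‖x‖ ^ 2) • (1 : QH) := by
  rw [norm_sq_eq]
  apply Quaternion.ext <;> simp <;> ring

lemma toQbar_mul_toQ (x : R3) : toQbar x * toQ x = (‖x‖ ^ 2) • (1 : QH) := by
  rw [norm_sq_eq]
  apply Quaternion.ext <;> simp <;> ring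

lemma commute_toQ_toQbar (x : R3) : Commute (toQ x) (toQbar x) :=
  (toQ_mul_toQbar x).trans (toQbar_mul_toQ x).symm

lemma toQ_pow_succ_mul_toQbar_pow_succ (x : R3) (h k : ℕ) :
    toQ x ^ (h + 1) * toQbar x ^ (k + 1) = (‖x‖ ^ 2) • (toQ x ^ h * toQbar x ^ k) := by
  rw [pow_succ, pow_succ', mul_assoc, ← mul_assoc (toQ x), toQ_mul_toQbar]
  simp

lemma commute_zeta (x y : R3) : Commute (zeta x) (zeta y) := by
  unfold Commute SemiconjBy
  apply Quaternion.ext <;> simp <;> ring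

lemma toQ_add_toQbar (x : R3) : toQ x + toQbar x = (2 * x 0) • (1 : QH) := by
  apply Quaternion.ext <;> simp [two_mul]

lemma contDiffAt_outerSum (l m : ℕ) {x : R3} (hx : x ≠ 0) : ContDiffAt ℝ 2 (outerSum l m) x := by
  have h1 : ContDiff ℝ 2 toQ := by
    rw [funext toQ_eq]; fun_prop
  have h2 : ContDiff ℝ 2 toQbar := by
    rw [funext toQbar_eq]; fun_prop
  have h3 : ContDiff ℝ 2 zeta := by
    rw [funext zeta_eq]; fun_prop
  have h4 : ContDiffAt ℝ 2 (fun y : R3 => (‖y‖ ^ (2 * (l + m) + 3))⁻¹) x :=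
    ((contDiffAt_norm ℝ hx).pow _).inv (by positivity)
  unfold outerSum
  refine ContDiffAt.mul (ContDiffAt.sum fun h _ => ?_) (h3.contDiffAt.pow l)
  exact (contDiffAt_const (c := appellCoeff l m h)).smul
    (h4.smul ((h1.contDiffAt.pow _).mul (h2.contDiffAt.pow _)))

lemma hasDerivAt_pow_of_commute {f : ℝ → QH} {f' : QH} {t : ℝ} (hf : HasDerivAt f f' t)
    (hc : Commute (f t) f') (k : ℕ) :
    HasDerivAt (fun s => f s ^ k) ((k : ℝ) • (f t ^ (k - 1) * f')) t := by
  induction k with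
  | zero => simpa using hasDerivAt_const t (1 : QH)
  | succ k ih =>
    simp only [pow_succ]
    refine (ih.mul hf).congr_deriv ?_
    rcases k with _ | k
    · simp
    · simp only [Nat.add_sub_cancel, smul_mul_assoc, mul_assoc, ← hc.eq]
      rw [← mul_assoc, ← pow_succ]
      push_cast
      module

/-- The line through `x` in the `i`-th coordinate direction. -/
def coordLine (i : Fin 3) (x : R3) (t : ℝ) : R3 := x + t • EuclideanSpace.single i 1

lemma coordLine_zero (i : Fin 3) (x : R3) : coordLine i x 0 = x := by simp [coordLine]

lemma pd_eq_of_hasDerivAt {i : Fin 3} {f : R3 → QH} {x : R3} {f' : QH}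
    (hf : DifferentiableAt ℝ f x) (h : HasDerivAt (fun t => f (coordLine i x t)) f' 0) :
    pd i f x = f' := by
  have h1 := hf.hasFDerivAt.hasLineDerivAt (EuclideanSpace.single i 1)
  exact HasDerivAt.unique h1 h

lemma hasDerivAt_coord (i j : Fin 3) (x : R3) :
    HasDerivAt (fun t => coordLine i x t j) (if j = i then 1 else 0) 0 := by
  have : (fun t => coordLine i x t j) = fun t => x j + t * (if j = i then 1 else 0) := by
    funext t; simp [coordLine, PiLp.single_apply]
  rw [this]
  simpa using ((hasDerivAt_id (0 : ℝ)).mul_const (if j = i then (1 : ℝ) else 0)).const_add (x j)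

lemma hasDerivAt_toQ (i : Fin 3) (x : R3) :
    HasDerivAt (fun t => toQ (coordLine i x t)) (toQ (EuclideanSpace.single i 1)) 0 := by
  simp only [toQ_eq]
  refine HasDerivAt.congr_deriv ((((hasDerivAt_coord i 0 x).smul_const (1 : QH)).add
    ((hasDerivAt_coord i 1 x).smul_const e1)).add ((hasDerivAt_coord i 2 x).smul_const e2)) ?_
  simp [PiLp.single_apply]

lemma hasDerivAt_toQbar (i : Fin 3) (x : R3) :
    HasDerivAt (fun t => toQbar (coordLine i x t)) (toQbar (EuclideanSpace.single i 1)) 0 := by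
  simp only [toQbar_eq]
  refine HasDerivAt.congr_deriv ((((hasDerivAt_coord i 0 x).smul_const (1 : QH)).sub
    ((hasDerivAt_coord i 1 x).smul_const e1)).sub ((hasDerivAt_coord i 2 x).smul_const e2)) ?_
  simp [PiLp.single_apply]

lemma hasDerivAt_zeta_pow (i : Fin 3) (x : R3) (l : ℕ) :
    HasDerivAt (fun t => zeta (coordLine i x t) ^ l)
      ((l : ℝ) • (zeta x ^ (l - 1) * zeta (EuclideanSpace.single i 1))) 0 := by
  have h : HasDerivAt (fun t => zeta (coordLine i x t)) (zeta (EuclideanSpace.single i 1)) 0 := by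
    simp only [zeta_eq]
    refine HasDerivAt.congr_deriv (((hasDerivAt_coord i 1 x).smul_const (1 : QH)).sub
      ((hasDerivAt_coord i 2 x).smul_const e3)) ?_
    simp [PiLp.single_apply]
  simpa only [coordLine_zero] using hasDerivAt_pow_of_commute h (commute_zeta _ _) l

lemma hasDerivAt_norm_pow_inv (i : Fin 3) {x : R3} (hx : x ≠ 0) (s : ℕ) :
    HasDerivAt (fun t => (‖coordLine i x t‖ ^ s)⁻¹) (-(s * x i * (‖x‖ ^ (s + 2))⁻¹)) 0 := by
  have hn : 0 < ‖x‖ := norm_pos_iff.mpr hx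
  have h2 : HasDerivAt (fun t => ‖coordLine i x t‖ ^ 2) (2 * x i) 0 := by
    simp only [norm_sq_eq]
    refine HasDerivAt.congr_deriv ((((hasDerivAt_coord i 0 x).pow 2).add
      ((hasDerivAt_coord i 1 x).pow 2)).add
      ((hasDerivAt_coord i 2 x).pow 2)) ?_
    fin_cases i <;> simp [coordLine_zero]
  have h1 : HasDerivAt (fun t => ‖coordLine i x t‖) (x i / ‖x‖) 0 := by
    have := h2.sqrt (by rw [coordLine_zero]; positivity)
    simp only [Real.sqrt_sq (norm_nonneg _), coordLine_zero] at this
    refine this.congr_deriv ?_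
    field_simp
  refine ((h1.pow s).inv (by simp only [Pi.pow_apply, coordLine_zero]; positivity)).congr_deriv ?_
  simp only [Pi.pow_apply, coordLine_zero]
  rcases s with _ | s
  · simp
  · simp only [Nat.add_sub_cancel]
    field_simp
    ring

lemma hasDerivAt_norm_smul_monomial {x : R3} (hx : x ≠ 0) (s h k : ℕ) :
    HasDerivAt (fun t => (‖coordLine 0 x t‖ ^ s)⁻¹ •
        (toQ (coordLine 0 x t) ^ h * toQbar (coordLine 0 x t) ^ k))
      ((h - s / 2 : ℝ) • ((‖x‖ ^ (s + 2))⁻¹ • (toQ x ^ h * toQbar x ^ (k + 1))) +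
        (k - s / 2 : ℝ) • ((‖x‖ ^ (s + 2))⁻¹ • (toQ x ^ (h + 1) * toQbar x ^ k))) 0 := by
  have e0 : toQ (EuclideanSpace.single (0 : Fin 3) 1) = 1 := by
    apply Quaternion.ext <;> simp
  have e0' : toQbar (EuclideanSpace.single (0 : Fin 3) 1) = 1 := by
    apply Quaternion.ext <;> simp
  have hQ := hasDerivAt_toQ 0 x
  have hB := hasDerivAt_toQbar 0 x
  rw [e0] at hQ
  rw [e0'] at hB
  have key := (hasDerivAt_norm_pow_inv 0 hx s).smul
    ((hasDerivAt_pow_of_commute hQ (Commute.one_right _) h).mul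
      (hasDerivAt_pow_of_commute hB (Commute.one_right _) k))
  simp only [Pi.mul_apply, coordLine_zero, mul_one] at key
  refine key.congr_deriv ?_
  have hn : ‖x‖ ≠ 0 := norm_ne_zero_iff.mpr hx
  have hN : (‖x‖ ^ s)⁻¹ = (‖x‖ ^ (s + 2))⁻¹ * ‖x‖ ^ 2 := by
    rw [pow_add]
    field_simp
  have A : (‖x‖ ^ 2) • ((h : ℝ) • (toQ x ^ (h - 1)) * toQbar x ^ k)
      = (h : ℝ) • (toQ x ^ h * toQbar x ^ (k + 1)) := by
    rcases h with _ | h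
    · simp
    · rw [toQ_pow_succ_mul_toQbar_pow_succ, Nat.add_sub_cancel, smul_mul_assoc, smul_comm]
  have B : (‖x‖ ^ 2) • (toQ x ^ h * (k : ℝ) • (toQbar x ^ (k - 1)))
      = (k : ℝ) • (toQ x ^ (h + 1) * toQbar x ^ k) := by
    rcases k with _ | k
    · simp
    · rw [toQ_pow_succ_mul_toQbar_pow_succ, Nat.add_sub_cancel, mul_smul_comm, smul_comm]
  have C : (2 * x 0) • (toQ x ^ h * toQbar x ^ k)
      = toQ x ^ (h + 1) * toQbar x ^ k + toQ x ^ h * toQbar x ^ (k + 1) := by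
    have : toQ x ^ h * ((toQ x + toQbar x) * toQbar x ^ k)
        = (2 * x 0) • (toQ x ^ h * toQbar x ^ k) := by
      rw [toQ_add_toQbar]; simp
    rw [← this, pow_succ, pow_succ', add_mul, mul_add, mul_assoc]
  have C' : (x 0) • (toQ x ^ h * toQbar x ^ k)
      = (1 / 2 : ℝ) • (toQ x ^ (h + 1) * toQbar x ^ k + toQ x ^ h * toQbar x ^ (k + 1)) := by
    rw [← C, smul_smul]; congr 1; ring
  rw [hN, mul_smul, smul_add, A, B,
    show -((s : ℝ) * x 0 * (‖x‖ ^ (s + 2))⁻¹) = -((s : ℝ) * (‖x‖ ^ (s + 2))⁻¹) * x 0 by ring,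
    mul_smul, C']
  module

lemma hasDerivAt_outerSum (l m : ℕ) {x : R3} (hx : x ≠ 0) :
    HasDerivAt (fun t => outerSum l m (coordLine 0 x t))
      ((-((m : ℝ) + 1) / 4) • outerSum l (m + 1) x) 0 := by
  have hz := hasDerivAt_zeta_pow 0 x l
  have e0 : zeta (EuclideanSpace.single (0 : Fin 3) 1) = 0 := by
    apply Quaternion.ext <;> simp
  rw [e0, mul_zero, smul_zero] at hz
  have hs := HasDerivAt.fun_sum (u := Finset.range (m + 1)) fun h _ =>
    (hasDerivAt_norm_smul_monomial hx (2 * (l + m) + 3) h (m + 1 - h)).const_smul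
      (appellCoeff l m h)
  refine (hs.mul hz).congr_deriv ?_
  simp only [mul_zero, add_zero, coordLine_zero]
  unfold outerSum
  rw [← smul_mul_assoc]
  congr 1
  have hexp : 2 * (l + (m + 1)) + 3 = 2 * (l + m) + 3 + 2 := by ring
  rw [hexp]
  set c := (‖x‖ ^ (2 * (l + m) + 3 + 2))⁻¹
  have hterm : ∀ h ∈ Finset.range (m + 1),
      appellCoeff l m h • ((h - ((2 * (l + m) + 3 : ℕ) : ℝ) / 2 : ℝ) •
          (c • (toQ x ^ h * toQbar x ^ (m + 1 - h + 1))) +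
        (((m + 1 - h : ℕ) : ℝ) - ((2 * (l + m) + 3 : ℕ) : ℝ) / 2 : ℝ) •
          (c • (toQ x ^ (h + 1) * toQbar x ^ (m + 1 - h)))) =
      (-1 / 4 : ℝ) • ((((m : ℝ) + 1 - h) * appellCoeff l (m + 1) h) •
          (c • (toQ x ^ h * toQbar x ^ (m + 1 + 1 - h)))) +
      (-1 / 4 : ℝ) • ((((h + 1 : ℕ) : ℝ) * appellCoeff l (m + 1) (h + 1)) •
          (c • (toQ x ^ (h + 1) * toQbar x ^ (m + 1 + 1 - (h + 1))))) := by
    intro h hh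
    have hle : h ≤ m := Nat.lt_succ_iff.mp (Finset.mem_range.mp hh)
    rw [appellCoeff_succ hle, Nat.cast_succ h, appellCoeff_succ_succ hle,
      show m + 1 + 1 - (h + 1) = m + 1 - h by omega, show m + 1 + 1 - h = m + 1 - h + 1 by omega,
      Nat.cast_sub (by omega : h ≤ m + 1)]
    push_cast
    module
  rw [Finset.sum_congr rfl hterm, Finset.sum_add_distrib, ← Finset.smul_sum, ← Finset.smul_sum]
  have h1 := Finset.sum_range_succ (fun h : ℕ => (((m : ℝ) + 1 - h) * appellCoeff l (m + 1) h) •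
          (c • (toQ x ^ h * toQbar x ^ (m + 1 + 1 - h)))) (m + 1)
  have h2 := Finset.sum_range_succ' (fun h : ℕ => ((h : ℝ) * appellCoeff l (m + 1) h) •
          (c • (toQ x ^ h * toQbar x ^ (m + 1 + 1 - h)))) (m + 1)
  simp only [Nat.cast_succ, sub_self, Nat.cast_zero, zero_mul, zero_smul, add_zero] at h1 h2 ⊢
  rw [← h1, ← h2, ← smul_add, ← Finset.sum_add_distrib, Finset.smul_sum, Finset.smul_sum]
  refine Finset.sum_congr rfl fun h _ => ?_
  module

lemma pd_zero_outerSum (l m : ℕ) {x : R3} (hx : x ≠ 0) :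
    pd 0 (outerSum l m) x = (-((m : ℝ) + 1) / 4) • outerSum l (m + 1) x :=
  pd_eq_of_hasDerivAt ((contDiffAt_outerSum l m hx).differentiableAt (by norm_num))
    (hasDerivAt_outerSum l m hx)

lemma pd_const_smul (i : Fin 3) (c : ℝ) {f : R3 → QH} {x : R3} (hf : DifferentiableAt ℝ f x) :
    pd i (fun y => c • f y) x = c • pd i f x := by
  simp [pd, fderiv_fun_const_smul hf]

lemma CRbar_const_smul (c : ℝ) {f : R3 → QH} {x : R3} (hf : DifferentiableAt ℝ f x) :
    CRbar (fun y => c • f y) x = c • CRbar f x := by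
  simp [CRbar, pd_const_smul _ c hf]

lemma D0_eq_pd_zero_sub (f : R3 → QH) (x : R3) : D0 f x = pd 0 f x - (1 / 2 : ℝ) • CRbar f x := by
  simp only [D0, CRbar]
  module

lemma pd_congr {i : Fin 3} {f g : R3 → QH} {x : R3} (h : f =ᶠ[nhds x] g) : pd i f x = pd i g x := by
  simp only [pd, h.fderiv_eq]

lemma differentiableAt_pd (i : Fin 3) {f : R3 → QH} {x : R3} (hf : ContDiffAt ℝ 2 f x) :
    DifferentiableAt ℝ (pd i f) x := by
  have h : DifferentiableAt ℝ (fderiv ℝ f) x :=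
    (hf.fderiv_right (m := 1) (by norm_num)).differentiableAt (by norm_num)
  exact h.clm_apply (differentiableAt_const _)

lemma pd_comm (i j : Fin 3) {f : R3 → QH} {x : R3} (hf : ContDiffAt ℝ 2 f x) :
    pd i (pd j f) x = pd j (pd i f) x := by
  have h : DifferentiableAt ℝ (fderiv ℝ f) x :=
    (hf.fderiv_right (m := 1) (by norm_num)).differentiableAt (by norm_num)
  have key : ∀ i j : Fin 3, pd i (pd j f) x =
      fderiv ℝ (fderiv ℝ f) x (EuclideanSpace.single i 1) (EuclideanSpace.single j 1) := by
    intro i j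
    unfold pd
    rw [fderiv_clm_apply h (differentiableAt_const _)]
    simp
  rw [key, key]
  exact hf.isSymmSndFDerivAt (by simp) _ _

lemma CRbar_pd (i : Fin 3) {f : R3 → QH} {x : R3} (hf : ContDiffAt ℝ 2 f x) :
    CRbar (pd i f) x = pd i (CRbar f) x := by
  have h0 := differentiableAt_pd 0 hf
  have h1 := differentiableAt_pd 1 hf
  have h2 := differentiableAt_pd 2 hf
  have h : HasFDerivAt (CRbar f) _ x :=
    (h0.hasFDerivAt.add (h1.hasFDerivAt.const_mul e1)).add (h2.hasFDerivAt.const_mul e2)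
  have : pd i (CRbar f) x = pd i (pd 0 f) x + e1 * pd i (pd 1 f) x + e2 * pd i (pd 2 f) x := by
    rw [pd, h.fderiv]
    simp [pd]
  rw [this, CRbar, pd_comm 0 i hf, pd_comm 1 i hf, pd_comm 2 i hf]

lemma CRbar_outerSum_zero (l : ℕ) {x : R3} (hx : x ≠ 0) : CRbar (outerSum l 0) x = 0 := by
  have hpd : ∀ i : Fin 3, pd i (outerSum l 0) x = appellCoeff l 0 0 •
      (((‖x‖ ^ (2 * l + 3))⁻¹ • toQbar (EuclideanSpace.single i 1) +
        (-(((2 * l + 3 : ℕ) : ℝ) * x i * (‖x‖ ^ (2 * l + 3 + 2))⁻¹)) • toQbar x) * zeta x ^ l +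
      ((‖x‖ ^ (2 * l + 3))⁻¹ • toQbar x) *
        ((l : ℝ) • (zeta (EuclideanSpace.single i 1) * zeta x ^ (l - 1)))) := by
    intro i
    refine pd_eq_of_hasDerivAt ((contDiffAt_outerSum l 0 hx).differentiableAt (by norm_num)) ?_
    have := ((((hasDerivAt_norm_pow_inv i hx (2 * l + 3)).smul (hasDerivAt_toQbar i x)).mul
      (hasDerivAt_zeta_pow i x l)).const_smul (appellCoeff l 0 0))
    simp only [Pi.smul_apply', coordLine_zero,
      ((commute_zeta x (EuclideanSpace.single i 1)).pow_left (l - 1)).eq] at this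
    refine this.congr_of_eventuallyEq (Filter.Eventually.of_forall fun t => ?_)
    simp [outerSum]
  have hn : ‖x‖ ≠ 0 := norm_ne_zero_iff.mpr hx
  have hN : (‖x‖ ^ (2 * l + 3))⁻¹ = (‖x‖ ^ (2 * l + 3 + 2))⁻¹ * ‖x‖ ^ 2 := by
    rw [pow_add _ (2 * l + 3)]
    field_simp
  have h_radial : x 0 • (toQbar x * zeta x ^ l) + x 1 • (e1 * (toQbar x * zeta x ^ l)) +
      x 2 • (e2 * (toQbar x * zeta x ^ l)) = ‖x‖ ^ 2 • zeta x ^ l := by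
    have := congrArg (· * zeta x ^ l) (toQ_mul_toQbar x)
    simpa [toQ_eq x, add_mul, mul_assoc] using this
  have h_conj : toQbar (EuclideanSpace.single 0 1) * zeta x ^ l +
      e1 * (toQbar (EuclideanSpace.single 1 1) * zeta x ^ l) +
      e2 * (toQbar (EuclideanSpace.single 2 1) * zeta x ^ l) = (3 : ℝ) • zeta x ^ l := by
    have : toQbar (EuclideanSpace.single 0 1) + e1 * toQbar (EuclideanSpace.single 1 1) +
        e2 * toQbar (EuclideanSpace.single 2 1) = (3 : ℝ) • (1 : QH) := by
      apply Quaternion.ext <;> simp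
      norm_num
    simpa [add_mul, mul_assoc] using congrArg (· * zeta x ^ l) this
  have h_zeta : (l : ℝ) • (toQbar x * (zeta (EuclideanSpace.single 0 1) * zeta x ^ (l - 1)) +
      e1 * (toQbar x * (zeta (EuclideanSpace.single 1 1) * zeta x ^ (l - 1))) +
      e2 * (toQbar x * (zeta (EuclideanSpace.single 2 1) * zeta x ^ (l - 1)))) =
      (2 * l : ℝ) • zeta x ^ l := by
    rcases l with _ | k
    · simp
    · have : toQbar x * zeta (EuclideanSpace.single 0 1) +
          e1 * (toQbar x * zeta (EuclideanSpace.single 1 1)) +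
          e2 * (toQbar x * zeta (EuclideanSpace.single 2 1)) = (2 : ℝ) • zeta x := by
        apply Quaternion.ext <;> simp <;> ring
      have := congrArg (· * zeta x ^ k) this
      simp only [add_mul, mul_assoc, smul_mul_assoc, ← pow_succ'] at this
      rw [Nat.add_sub_cancel, this, smul_smul, mul_comm (2 : ℝ)]
  simp only [CRbar, hpd, hN, mul_smul_comm, smul_mul_assoc, mul_add, add_mul, smul_add] at h_zeta ⊢
  push_cast
  set a := (‖x‖ ^ (2 * l + 3 + 2))⁻¹
  linear_combination (norm := module) (appellCoeff l 0 0 * a * ‖x‖ ^ 2) • h_conj -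
    (appellCoeff l 0 0 * (2 * l + 3) * a) • h_radial + (appellCoeff l 0 0 * a * ‖x‖ ^ 2) • h_zeta

lemma CRbar_outerSum (l m : ℕ) {x : R3} (hx : x ≠ 0) : CRbar (outerSum l m) x = 0 := by
  induction m generalizing x with
  | zero => exact CRbar_outerSum_zero l hx
  | succ m ih =>
    have hne : ∀ᶠ y in nhds x, y ≠ 0 := isOpen_ne.mem_nhds hx
    have h1 : CRbar (pd 0 (outerSum l m)) x = 0 := by
      rw [CRbar_pd 0 (contDiffAt_outerSum l m hx),
        pd_congr (g := fun _ => 0) (hne.mono fun y hy => ih hy)]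
      simp [pd]
    have h2 : pd 0 (outerSum l m) =ᶠ[nhds x]
        fun y => (-((m : ℝ) + 1) / 4) • outerSum l (m + 1) y :=
      hne.mono fun y hy => pd_zero_outerSum l m hy
    have h3 : CRbar (pd 0 (outerSum l m)) x =
        (-((m : ℝ) + 1) / 4) • CRbar (outerSum l (m + 1)) x := by
      rw [← CRbar_const_smul _
        ((contDiffAt_outerSum l (m + 1) hx).differentiableAt (by norm_num))]
      simp only [CRbar, pd_congr h2]
    rw [h1] at h3
    have hm : (-((m : ℝ) + 1) / 4) ≠ 0 := by
      have : (0 : ℝ) < (m : ℝ) + 1 := by positivity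
      exact div_ne_zero (neg_ne_zero.mpr this.ne') four_ne_zero
    exact (smul_eq_zero.mp h3.symm).resolve_left hm

lemma toQ_smul_barPt (c : ℝ) (x : R3) : toQ (c • barPt x) = c • toQbar x := by
  apply Quaternion.ext <;> simp [barPt, mk3]

lemma toQbar_smul_barPt (c : ℝ) (x : R3) : toQbar (c • barPt x) = c • toQ x := by
  apply Quaternion.ext <;> simp [barPt, mk3]

lemma zeta_smul_barPt (c : ℝ) (x : R3) : zeta (c • barPt x) = (-c) • zeta x := by
  apply Quaternion.ext <;> simp [barPt, mk3]

lemma kelvin_appell (l m : ℕ) (x : R3) :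
    kelvin (appell (l + m) l) x = (((l + m).factorial * l.factorial : ℝ) /
      (2 ^ (2 * m) * (l + m + l + 1).factorial * (2 * l).factorial)) •
        ((-1 : ℝ) ^ l • outerSum l m x) := by
  unfold kelvin appell outerSum
  simp only [toQ_smul_barPt, toQbar_smul_barPt, zeta_smul_barPt, Nat.add_sub_cancel_left, smul_pow,
    mul_smul_comm, smul_mul_assoc, ← mul_assoc, Finset.mul_sum]
  congr 1
  rw [← smul_mul_assoc, ← smul_mul_assoc, Finset.smul_sum, Finset.smul_sum]
  congr 1
  refine Finset.sum_congr rfl fun h hh => ?_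
  have hle : h ≤ m := Nat.lt_succ_iff.mp (Finset.mem_range.mp hh)
  have hmon : toQbar x * toQ x ^ h * toQbar x ^ (m - h) = toQ x ^ h * toQbar x ^ (m + 1 - h) := by
    rw [← ((commute_toQ_toQbar x).pow_left h).eq, mul_assoc, ← pow_succ',
      show m - h + 1 = m + 1 - h by omega]
  rw [hmon]
  simp only [smul_smul]
  congr 1
  obtain ⟨k, rfl⟩ := Nat.exists_eq_add_of_le hle
  rw [Nat.add_sub_cancel_left, neg_pow]
  simp only [inv_pow, ← pow_mul, appellCoeff, Nat.add_sub_cancel_left]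
  rw [show 2 * (l + (h + k)) + 3 = 3 + 2 * l + 2 * h + 2 * k by ring]
  simp only [pow_add, mul_inv]
  ring

lemma outerAppell_eq (l m : ℕ) (x : R3) :
    outerAppell (l + m) l x =
      ((-1) ^ l * (m.factorial * l.factorial) /
        ((l + m + 1).factorial * 4 ^ m * (2 * l).factorial) : ℝ) • outerSum l m x := by
  unfold outerAppell
  rw [kelvin_appell, smul_smul, smul_smul, Nat.add_sub_cancel_left, pow_mul]
  congr 1
  norm_num
  field_simp

/-- the outer Appell property ∂₀A_{-(n+2)}^l = -(n+2)·A_{-(n+3)}^l on ℝ³\{0}. -/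
theorem outer_appell_property (n l : ℕ) (hl : l ≤ n) (x : R3) (hx : x ≠ 0) :
    D0 (outerAppell n l) x = (-((n : ℝ) + 2)) • outerAppell (n + 1) l x := by
  obtain ⟨m, rfl⟩ := Nat.exists_eq_add_of_le hl
  have hd : DifferentiableAt ℝ (outerSum l m) x :=
    (contDiffAt_outerSum l m hx).differentiableAt (by norm_num)
  rw [funext (outerAppell_eq l m), D0_eq_pd_zero_sub, CRbar_const_smul _ hd, CRbar_outerSum l m hx,
    pd_const_smul _ _ hd, pd_zero_outerSum l m hx, add_assoc l m 1, outerAppell_eq l (m + 1),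
    smul_zero, smul_zero, sub_zero, smul_smul, smul_smul]
  congr 1
  rw [show l + (m + 1) + 1 = l + m + 1 + 1 by ring, Nat.factorial_succ (l + m + 1),
    Nat.factorial_succ m]
  push_cast
  field_simp
  ring_nf
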